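/- arXiv:2402.06017 — 5 statements merged into one kernel-verified Lean document; each statement's English description precedes it below -/
import Mathlib

section
/- Let G be the group given by the presentation with generators x_1, …, x_10 and with relators: x_i² for i = 1,…,10; (x_i x_j)³ for each pair {i,j} ∈ {{1,2},{1,4},{2,3},{3,5},{4,6},{5,10},{6,7},{7,8},{8,9},{9,10}}; (x_5 · x_10 x_9 x_10)³; (x_5 · x_10 x_9 x_10 x_8 x_10 x_9 x_10)³; (x_5 · x_10 x_9 x_10 x_8 x_10 x_9 x_10 x_7 x_10 x_9 x_10 x_8 x_10 x_9 x_10)³; the relator identifying x_4 x_3 x_2 x_1 x_2 x_3 x_4 with x_6 x_7 x_10 x_9 x_10 x_8 x_10 x_9 x_10 x_7 x_5 x_7 x_10 x_9 x_10 x_8 x_10 x_9 x_10 x_7 x_6; and (x_i x_j)² for each pair {i,j} ∈ {{1,3},{1,5},{1,6},{1,7},{1,8},{1,9},{1,10},{2,6},{2,7},{2,8},{2,9},{2,10},{3,4},{3,6},{3,7},{3,8},{3,9},{3,10},{4,8},{4,9},{4,10},{5,6},{6,8},{6,9},{6,10},{7,9},{7,10},{8,10}}. Then G is isomorphic to the symmetric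 group S_10 on 10 letters. -/
/-- Index set `{1,…,10}` for the generators `x_1,…,x_10`. -/
abbrev ZapIdx10 : Type := {i : ℕ // 1 ≤ i ∧ i ≤ 10}

/-- The generator `x_i` of the free group, for `1 ≤ i ≤ 10`. -/
def zx (i : ℕ) (h : 1 ≤ i ∧ i ≤ 10 := by norm_num) : FreeGroup ZapIdx10 :=
  FreeGroup.of ⟨i, h⟩

/-- The relators of the presentation of `G^{10}_*`. -/
def ZapRels10 : Set (FreeGroup ZapIdx10) :=
  -- squares of the generators
  {r | ∃ i : ZapIdx10, r = FreeGroup.of i ^ 2} ∪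
  -- braid (cusp) relators and the extra long relators
  {(zx 1 * zx 2) ^ 3, (zx 1 * zx 4) ^ 3, (zx 2 * zx 3) ^ 3, (zx 3 * zx 5) ^ 3,
   (zx 4 * zx 6) ^ 3, (zx 5 * zx 10) ^ 3, (zx 6 * zx 7) ^ 3, (zx 7 * zx 8) ^ 3,
   (zx 8 * zx 9) ^ 3, (zx 9 * zx 10) ^ 3,
   (zx 5 * (zx 10 * zx 9 * zx 10)) ^ 3,
   (zx 5 * (zx 10 * zx 9 * zx 10 * zx 8 * zx 10 * zx 9 * zx 10)) ^ 3,
   (zx 5 * (zx 10 * zx 9 * zx 10 * zx 8 * zx 10 * zx 9 * zx 10 * zx 7 *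
      zx 10 * zx 9 * zx 10 * zx 8 * zx 10 * zx 9 * zx 10)) ^ 3,
   (zx 4 * zx 3 * zx 2 * zx 1 * zx 2 * zx 3 * zx 4) *
     (zx 6 * zx 7 * zx 10 * zx 9 * zx 10 * zx 8 * zx 10 * zx 9 * zx 10 * zx 7 *
      zx 5 * zx 7 * zx 10 * zx 9 * zx 10 * zx 8 * zx 10 * zx 9 * zx 10 * zx 7 * zx 6)⁻¹} ∪
  -- commutation (node) relators
  {(zx 1 * zx 3) ^ 2, (zx 1 * zx 5) ^ 2, (zx 1 * zx 6) ^ 2, (zx 1 * zx 7) ^ 2,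
   (zx 1 * zx 8) ^ 2, (zx 1 * zx 9) ^ 2, (zx 1 * zx 10) ^ 2,
   (zx 2 * zx 6) ^ 2, (zx 2 * zx 7) ^ 2, (zx 2 * zx 8) ^ 2, (zx 2 * zx 9) ^ 2,
   (zx 2 * zx 10) ^ 2,
   (zx 3 * zx 4) ^ 2, (zx 3 * zx 6) ^ 2, (zx 3 * zx 7) ^ 2, (zx 3 * zx 8) ^ 2,
   (zx 3 * zx 9) ^ 2, (zx 3 * zx 10) ^ 2,
   (zx 4 * zx 8) ^ 2, (zx 4 * zx 9) ^ 2, (zx 4 * zx 10) ^ 2,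
   (zx 5 * zx 6) ^ 2,
   (zx 6 * zx 8) ^ 2, (zx 6 * zx 9) ^ 2, (zx 6 * zx 10) ^ 2,
   (zx 7 * zx 9) ^ 2, (zx 7 * zx 10) ^ 2,
   (zx 8 * zx 10) ^ 2}

section TypeA

open scoped Pointwise

variable {G : Type*} [Group G]

/-- The descending product `s (k + m - 1) * ⋯ * s (k + 1) * s k` of `m` consecutive terms. -/
def descProd (s : ℕ → G) (k : ℕ) : ℕ → G
  | 0 => 1
  | m + 1 => s (k + m) * descProd s k m

lemma descProd_succ' (s : ℕ → G) (k m : ℕ) :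
    descProd s k (m + 1) = descProd s (k + 1) m * s k := by
  induction m with
  | zero => simp [descProd]
  | succ m ih =>
    rw [descProd, ih, descProd, mul_assoc, Nat.add_right_comm k 1 m, Nat.add_assoc k m 1]

/-- The Coxeter relations of type `A_n` for `s 0, …, s (n - 1)`. -/
structure TypeARelations (s : ℕ → G) (n : ℕ) : Prop where
  mul_self : ∀ i < n, s i * s i = 1
  braid : ∀ i, i + 1 < n → s (i + 1) * s i * s (i + 1) = s i * s (i + 1) * s i
  comm : ∀ i j, i + 1 < j → j < n → Commute (s i) (s j)

namespace TypeARelations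

variable {s : ℕ → G} {n : ℕ}

lemma mono (h : TypeARelations s n) {m : ℕ} (hm : m ≤ n) : TypeARelations s m where
  mul_self i hi := h.mul_self i (by omega)
  braid i hi := h.braid i (by omega)
  comm i j hij hj := h.comm i j hij (by omega)

lemma commute_descProd_of_lt (h : TypeARelations s n) {i k : ℕ} (hik : i + 1 < k) {m : ℕ}
    (hm : k + m ≤ n) : Commute (s i) (descProd s k m) := by
  induction m with
  | zero => exact Commute.one_right _
  | succ m ih => exact (h.comm i _ (by omega) (by omega)).mul_right (ih (by omega))

lemma commute_descProd_of_gt (h : TypeARelations s n) {i k m : ℕ} (hm : k + m < i)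
    (hi : i < n) : Commute (s i) (descProd s k m) := by
  induction m with
  | zero => exact Commute.one_right _
  | succ m ih => exact (h.comm _ i (by omega) hi).symm.mul_right (ih (by omega))

lemma descProd_mul (h : TypeARelations s n) {j k m : ℕ} (hj : j + 1 < m) (hm : k + m ≤ n) :
    descProd s k m * s (k + j + 1) = s (k + j) * descProd s k m := by
  induction m, hj using Nat.le_induction with
  | base =>
    have hc := h.commute_descProd_of_gt (i := k + j + 1) (k := k) (m := j) (by omega) (by omega)
    have hb := h.braid (k + j) (by omega)
    simp only [descProd, ← Nat.add_assoc] at *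
    rw [mul_assoc, mul_assoc, ← hc.eq, ← mul_assoc, ← mul_assoc, hb]
    simp only [mul_assoc]
  | succ m hjm ih =>
    rw [descProd, mul_assoc, ih (by omega), ← mul_assoc,
      ← (h.comm (k + j) (k + m) (by omega) (by omega)).eq, mul_assoc]

/-- Every element of the subgroup generated by `s 0, …, s n` is the product of an element of the
subgroup generated by `s 0, …, s (n - 1)` and a descending product ending at `s n`. -/
lemma closure_succ_subset (h : TypeARelations s (n + 1)) :
    (Subgroup.closure (s '' Set.Iio (n + 1)) : Set G) ⊆
      (Subgroup.closure (s '' Set.Iio n) : Set G) *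
        Set.range fun k : Fin (n + 2) => descProd s k (n + 1 - k) := by
  have step : ∀ x ∈ (Subgroup.closure (s '' Set.Iio n) : Set G) *
      Set.range (fun k : Fin (n + 2) => descProd s k (n + 1 - k)), ∀ i < n + 1,
      x * s i ∈ (Subgroup.closure (s '' Set.Iio n) : Set G) *
        Set.range fun k : Fin (n + 2) => descProd s k (n + 1 - k) := by
    rintro _ ⟨g, hg, _, ⟨⟨k, hk⟩, rfl⟩, rfl⟩ i hi
    have mem : ∀ j < n, s j ∈ Subgroup.closure (s '' Set.Iio n) := fun j hj =>
      Subgroup.subset_closure ⟨j, hj, rfl⟩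
    dsimp only
    rw [mul_assoc]
    rcases lt_trichotomy i k with hik | rfl | hik
    · obtain rfl | hik' : i + 1 = k ∨ i + 1 < k := by omega
      · refine ⟨g, hg, _, ⟨⟨i, by omega⟩, rfl⟩, ?_⟩
        dsimp only
        rw [← descProd_succ', show n + 1 - (i + 1) + 1 = n + 1 - i by omega]
      · refine ⟨g * s i, mul_mem hg (mem i (by omega)), _, ⟨⟨k, hk⟩, rfl⟩, ?_⟩
        dsimp only
        rw [← (h.commute_descProd_of_lt hik' (by omega)).eq, mul_assoc]
    · refine ⟨g, hg, _, ⟨⟨i + 1, by omega⟩, rfl⟩, ?_⟩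
      dsimp only
      rw [show n + 1 - i = n + 1 - (i + 1) + 1 by omega, descProd_succ', mul_assoc,
        h.mul_self i hi, mul_one]
    · obtain ⟨j, rfl⟩ := Nat.exists_eq_add_of_lt hik
      refine ⟨g * s (k + j), mul_mem hg (mem _ (by omega)), _, ⟨⟨k, hk⟩, rfl⟩, ?_⟩
      dsimp only
      rw [h.descProd_mul (by omega) (by omega), mul_assoc]
  intro x hx
  induction hx using Subgroup.closure_induction_right with
  | one => exact ⟨1, one_mem _, _, ⟨Fin.last (n + 1), rfl⟩, by simp [descProd]⟩
  | mul_right x hx y hy ih =>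
    obtain ⟨i, hi, rfl⟩ := hy
    exact step x ih i hi
  | mul_inv_cancel x hx y hy ih =>
    obtain ⟨i, hi, rfl⟩ := hy
    rw [inv_eq_of_mul_eq_one_left (h.mul_self i hi)]
    exact step x ih i hi

theorem finite_and_card_closure_le (h : TypeARelations s n) :
    (Subgroup.closure (s '' Set.Iio n) : Set G).Finite ∧
      Nat.card (Subgroup.closure (s '' Set.Iio n) : Set G) ≤ (n + 1).factorial := by
  induction n with
  | zero =>
    have : (Subgroup.closure (s '' Set.Iio 0) : Set G) = {1} := by simp
    rw [this]
    simp
  | succ n ih =>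
    obtain ⟨hfin, hcard⟩ := ih (h.mono n.le_succ)
    have hmul := hfin.mul (Set.finite_range fun k : Fin (n + 2) => descProd s k (n + 1 - k))
    refine ⟨hmul.subset h.closure_succ_subset,
      (Nat.card_mono hmul h.closure_succ_subset).trans (Set.natCard_mul_le.trans ?_)⟩
    rw [Nat.factorial_succ (n + 1), mul_comm]
    gcongr
    simpa using Finite.card_range_le fun k : Fin (n + 2) => descProd s k (n + 1 - k)

end TypeARelations

end TypeA

section Involutions

variable {G : Type*} [Group G] {a b s t : G}

lemma mul_mul_cancel_of_sq (hs : s * s = 1) (a : G) : s * (s * a) = a := by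
  rw [← mul_assoc, hs, one_mul]

lemma braid_of_pow_three (ha : a * a = 1) (hb : b * b = 1) (h : (a * b) ^ 3 = 1) :
    a * b * a = b * a * b := by
  rw [← inv_eq_of_mul_eq_one_left (a := b * a * b) (b := b * a * b)
    (by simp [mul_assoc, mul_mul_cancel_of_sq ha, mul_mul_cancel_of_sq hb, hb])]
  refine eq_inv_of_mul_eq_one_left ?_
  rw [← h]
  simp only [pow_succ, pow_zero, one_mul, mul_assoc]

lemma commute_of_pow_two (ha : a * a = 1) (hb : b * b = 1) (h : (a * b) ^ 2 = 1) :
    Commute a b := by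
  have : a * b = (a * b)⁻¹ := eq_inv_of_mul_eq_one_left (by rw [← h, pow_two])
  rwa [mul_inv_rev, inv_eq_of_mul_eq_one_left ha, inv_eq_of_mul_eq_one_left hb] at this

lemma conj_mul_conj (hs : s * s = 1) : s * a * s * (s * b * s) = s * (a * b) * s := by
  simp only [mul_assoc, mul_mul_cancel_of_sq hs]

lemma conj_conj (hs : s * s = 1) : s * (s * a * s) * s = a := by
  simp only [mul_assoc, mul_mul_cancel_of_sq hs, hs, mul_one]

lemma conj_eq_of_commute (hs : s * s = 1) (h : Commute s a) : s * a * s = a := by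
  rw [h.eq, mul_assoc, hs, mul_one]

lemma conj_mul_self (hs : s * s = 1) (ha : a * a = 1) : s * a * s * (s * a * s) = 1 := by
  rw [conj_mul_conj hs, ha, mul_one, hs]

lemma commute_conj_iff (hs : s * s = 1) :
    Commute (s * a * s) (s * b * s) ↔ Commute a b := by
  simp only [Commute, SemiconjBy, conj_mul_conj hs, mul_left_inj, mul_right_inj]

lemma commute_conj_left_iff (hs : s * s = 1) :
    Commute (s * a * s) b ↔ Commute a (s * b * s) := by
  rw [← commute_conj_iff hs, conj_conj hs]

/-- Conjugating by an involution that commutes with `a` preserves the braid relation. -/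
lemma braid_conj (hs : s * s = 1) (hsa : Commute s a) (h : a * b * a = b * a * b) :
    a * (s * b * s) * a = s * b * s * a * (s * b * s) := by
  have hca := conj_eq_of_commute hs hsa
  calc a * (s * b * s) * a = s * a * s * (s * b * s) * (s * a * s) := by rw [hca]
    _ = s * b * s * (s * a * s) * (s * b * s) := by simp only [conj_mul_conj hs, h]
    _ = _ := by rw [hca]

/-- Conjugation turns the commutation of `x₁` with the long word into one of `x₄` with `x₂`. -/
lemma commute_of_commute_conj_path {x₁ x₂ x₃ x₄ : G} (h₁ : x₁ * x₁ = 1) (h₃ : x₃ * x₃ = 1)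
    (h₄ : x₄ * x₄ = 1) (b₁₂ : x₁ * x₂ * x₁ = x₂ * x₁ * x₂) (b₁₄ : x₁ * x₄ * x₁ = x₄ * x₁ * x₄)
    (c₁₃ : Commute x₁ x₃) (c₃₄ : Commute x₃ x₄)
    (h : Commute x₁ (x₄ * (x₃ * (x₂ * x₁ * x₂) * x₃) * x₄)) : Commute x₄ x₂ := by
  have e : x₃ * (x₁ * x₂ * x₁) * x₃ = x₁ * (x₃ * x₂ * x₃) * x₁ := by
    calc _ = (x₃ * x₁) * x₂ * (x₁ * x₃) := by simp only [mul_assoc]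
      _ = (x₁ * x₃) * x₂ * (x₃ * x₁) := by rw [c₁₃.eq]
      _ = _ := by simp only [mul_assoc]
  rwa [← commute_conj_left_iff h₄, ← b₁₄, ← b₁₂, e, commute_conj_iff h₁,
    ← commute_conj_left_iff h₃, conj_eq_of_commute h₃ c₃₄] at h

lemma commute_conj_conj_of_braid (ha : a * a = 1) (hb : b * b = 1)
    (h : a * b * a = b * a * b) (ht : Commute t a) :
    Commute b (a * (b * t * b) * a) := by
  have e : a * (b * a * b) * a = b := by
    rw [← h, conj_conj ha]
  have := (commute_conj_iff ha).2 ((commute_conj_iff hb).2 ht.symm)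
  rwa [e] at this

/-- If `x₇` commutes with the long word and with `x₁, x₂, x₃`, then it commutes with `x₄`. -/
lemma commute_of_commute_conj_path' {x₁ x₂ x₃ x₄ x₇ : G} (h₁ : x₁ * x₁ = 1) (h₂ : x₂ * x₂ = 1)
    (h₃ : x₃ * x₃ = 1) (h₄ : x₄ * x₄ = 1) (b₁₄ : x₁ * x₄ * x₁ = x₄ * x₁ * x₄)
    (c₂₄ : Commute x₂ x₄) (c₃₄ : Commute x₃ x₄) (c₁₇ : Commute x₁ x₇) (c₂₇ : Commute x₂ x₇)
    (c₃₇ : Commute x₃ x₇)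
    (h : Commute x₇ (x₄ * (x₃ * (x₂ * x₁ * x₂) * x₃) * x₄)) : Commute x₄ x₇ := by
  have c₂ : Commute x₂ (x₄ * x₇ * x₄) := (c₂₄.mul_right c₂₇).mul_right c₂₄
  have c₃ : Commute x₃ (x₄ * x₇ * x₄) := (c₃₄.mul_right c₃₇).mul_right c₃₄
  rw [← commute_conj_left_iff h₄, ← commute_conj_left_iff h₃, conj_eq_of_commute h₃ c₃,
    ← commute_conj_left_iff h₂, conj_eq_of_commute h₂ c₂, commute_conj_left_iff h₄, ← b₁₄,
    ← commute_conj_left_iff h₁, conj_eq_of_commute h₁ c₁₇] at h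
  exact h.symm

/-- If `t` commutes with `b`, then its conjugate `a` by `b * (c * u * c)` commutes with
`c * u * c = u * c * u`, so that `c` commutes with `u * a * u`. -/
lemma commute_conj_of_eq_conj_conj {a b c t u : G} (hb : b * b = 1) (hc : c * c = 1)
    (hu : u * u = 1) (hbc : b * c * b = c * b * c) (hcu : c * u * c = u * c * u)
    (hub : Commute u b) (ht : Commute b t)
    (h : a = b * (c * (u * (c * t * c) * u) * c) * b) : Commute c (u * a * u) := by
  have hv : c * u * c * (c * u * c) = 1 := conj_mul_self hc hu
  have hbv : b * (c * u * c) * b = c * u * c * b * (c * u * c) := by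
    rw [hcu]
    exact braid_conj hu hub hbc
  have e : a = b * (c * u * c * t * (c * u * c)) * b := by
    rw [h]
    simp only [mul_assoc]
  have := commute_conj_conj_of_braid hb hv hbv ht.symm
  rwa [← e, hcu, commute_conj_left_iff hu] at this

/-- The two commutation relations along the path `x₃, x₂, x₁, x₄, x₆, x₇, x₈, x₉, x₁₀` that are not
among the relators of `G^{10}_*`. -/
lemma commute_of_long_relation {x₁ x₂ x₃ x₄ x₅ x₆ x₇ x₈ x₉ x₁₀ : G}
    (h₁ : x₁ * x₁ = 1) (h₂ : x₂ * x₂ = 1) (h₃ : x₃ * x₃ = 1) (h₄ : x₄ * x₄ = 1)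
    (h₆ : x₆ * x₆ = 1) (h₇ : x₇ * x₇ = 1) (h₈ : x₈ * x₈ = 1) (h₉ : x₉ * x₉ = 1)
    (h₁₀ : x₁₀ * x₁₀ = 1)
    (b₁₂ : x₁ * x₂ * x₁ = x₂ * x₁ * x₂) (b₁₄ : x₁ * x₄ * x₁ = x₄ * x₁ * x₄)
    (b₆₇ : x₆ * x₇ * x₆ = x₇ * x₆ * x₇) (b₇₈ : x₇ * x₈ * x₇ = x₈ * x₇ * x₈)
    (c₁ : ∀ y ∈ [x₃, x₅, x₆, x₇, x₈, x₉, x₁₀], Commute x₁ y)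
    (c₂ : ∀ y ∈ [x₇, x₈, x₉, x₁₀], Commute x₂ y)
    (c₃ : ∀ y ∈ [x₄, x₇, x₈, x₉, x₁₀], Commute x₃ y)
    (c₄ : ∀ y ∈ [x₈, x₉, x₁₀], Commute x₄ y)
    (c₆ : ∀ y ∈ [x₅, x₈, x₉, x₁₀], Commute x₆ y)
    (c₇ : ∀ y ∈ [x₉, x₁₀], Commute x₇ y)
    (long : x₄ * x₃ * x₂ * x₁ * x₂ * x₃ * x₄ =
      x₆ * x₇ * x₁₀ * x₉ * x₁₀ * x₈ * x₁₀ * x₉ * x₁₀ * x₇ * x₅ *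
        x₇ * x₁₀ * x₉ * x₁₀ * x₈ * x₁₀ * x₉ * x₁₀ * x₇ * x₆) :
    Commute x₄ x₂ ∧ Commute x₄ x₇ := by
  simp only [List.forall_mem_cons, List.not_mem_nil, false_imp_iff, implies_true, and_true]
    at c₁ c₂ c₃ c₄ c₆ c₇
  obtain ⟨c₁₃, c₁₅, c₁₆, c₁₇, c₁₈, c₁₉, c₁₁₀⟩ := c₁
  obtain ⟨c₂₇, c₂₈, c₂₉, c₂₁₀⟩ := c₂
  obtain ⟨c₃₄, c₃₇, c₃₈, c₃₉, c₃₁₀⟩ := c₃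
  obtain ⟨c₄₈, c₄₉, c₄₁₀⟩ := c₄
  obtain ⟨c₆₅, c₆₈, c₆₉, c₆₁₀⟩ := c₆
  obtain ⟨c₇₉, c₇₁₀⟩ := c₇
  have conj_right {y s t : G} (hs : Commute y s) (ht : Commute y t) : Commute y (s * t * s) :=
    (hs.mul_right ht).mul_right hs
  obtain ⟨g, hg⟩ : ∃ g, g = x₁₀ * x₉ * x₁₀ := ⟨_, rfl⟩
  obtain ⟨u, hu⟩ : ∃ u, u = g * x₈ * g := ⟨_, rfl⟩
  have comm_u {y : G} (h8 : Commute y x₈) (h9 : Commute y x₉) (h10 : Commute y x₁₀) :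
      Commute y u := by
    rw [hu, hg]
    exact conj_right (conj_right h10 h9) h8
  have g_sq : g * g = 1 := hg ▸ conj_mul_self h₁₀ h₉
  have u_sq : u * u = 1 := hu ▸ conj_mul_self g_sq h₈
  have c₇g : Commute x₇ g := hg ▸ conj_right c₇₁₀ c₇₉
  have b₇u : x₇ * u * x₇ = u * x₇ * u := hu ▸ braid_conj g_sq c₇g.symm b₇₈
  have ha : x₄ * (x₃ * (x₂ * x₁ * x₂) * x₃) * x₄ =
      x₆ * (x₇ * (u * (x₇ * x₅ * x₇) * u) * x₇) * x₆ := by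
    rw [hu, hg]
    simpa only [mul_assoc] using long
  have c₁u := comm_u c₁₈ c₁₉ c₁₁₀
  have c₂₄ : Commute x₄ x₂ := by
    refine commute_of_commute_conj_path h₁ h₃ h₄ b₁₂ b₁₄ c₁₃ c₃₄ ?_
    rw [ha]
    exact conj_right c₁₆ (conj_right c₁₇ (conj_right c₁u (conj_right c₁₇ c₁₅)))
  refine ⟨c₂₄, commute_of_commute_conj_path' h₁ h₂ h₃ h₄ b₁₄ c₂₄.symm c₃₄ c₁₇ c₂₇ c₃₇ ?_⟩
  have h := commute_conj_of_eq_conj_conj h₆ h₇ u_sq b₆₇ b₇u (comm_u c₆₈ c₆₉ c₆₁₀).symm c₆₅ ha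
  have c₃u := comm_u c₃₈ c₃₉ c₃₁₀
  have c₂u := comm_u c₂₈ c₂₉ c₂₁₀
  have c₄u := comm_u c₄₈ c₄₉ c₄₁₀
  rwa [conj_eq_of_commute u_sq (conj_right c₄u.symm
    (conj_right c₃u.symm (conj_right c₂u.symm c₁u.symm)))] at h

end Involutions

/-- The images of `x_1, …, x_10` in the symmetric group: the transpositions along a 10-cycle. -/
def zapSwap (i : ZapIdx10) : Equiv.Perm (Fin 10) :=
  ![Equiv.swap 2 3, Equiv.swap 1 2, Equiv.swap 0 1, Equiv.swap 3 4, Equiv.swap 0 9,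
    Equiv.swap 4 5, Equiv.swap 5 6, Equiv.swap 6 7, Equiv.swap 7 8, Equiv.swap 8 9]
    ⟨i.1 - 1, by have := i.2; omega⟩

lemma lift_zapSwap_eq_one : ∀ r ∈ ZapRels10, FreeGroup.lift zapSwap r = 1 := by
  suffices ZapRels10 ⊆ (FreeGroup.lift zapSwap).ker from this
  simp only [ZapRels10, Set.union_subset_iff, Set.insert_subset_iff, Set.singleton_subset_iff,
    SetLike.mem_coe, MonoidHom.mem_ker, map_mul, map_pow, map_inv, zx, FreeGroup.lift_apply_of]
  refine ⟨⟨?_, ?_⟩, ?_⟩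
  · rintro _ ⟨⟨i, hi⟩, rfl⟩
    simp only [SetLike.mem_coe, MonoidHom.mem_ker, map_pow, FreeGroup.lift_apply_of]
    obtain ⟨h₁, h₂⟩ := hi
    rw [pow_two]
    interval_cases i <;> exact Equiv.swap_mul_self _ _
  all_goals and_intros <;> decide +kernel

lemma toGroup_zapSwap_surjective :
    Function.Surjective (PresentedGroup.toGroup lift_zapSwap_eq_one) := by
  rw [← MonoidHom.range_eq_top, eq_top_iff,
    ← Subgroup.closure_eq_top_of_mclosure_eq_top (Equiv.Perm.mclosure_swap_castSucc_succ 9),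
    Subgroup.closure_le]
  rintro _ ⟨i, rfl⟩
  refine ⟨PresentedGroup.of
    (![⟨3, by simp⟩, ⟨2, by simp⟩, ⟨1, by simp⟩, ⟨4, by simp⟩, ⟨6, by simp⟩, ⟨7, by simp⟩,
      ⟨8, by simp⟩, ⟨9, by simp⟩, ⟨10, by simp⟩] i), ?_⟩
  rw [PresentedGroup.toGroup.of]
  fin_cases i <;> rfl

section Path

variable {H : Type*} [Group H] (φ : FreeGroup ZapIdx10 →* H)

/-- The images under `φ` of nine of the ten generators, ordered along a path. -/
def zapPath : ℕ → H
  | 0 => φ (zx 3)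
  | 1 => φ (zx 2)
  | 2 => φ (zx 1)
  | 3 => φ (zx 4)
  | 4 => φ (zx 6)
  | 5 => φ (zx 7)
  | 6 => φ (zx 8)
  | 7 => φ (zx 9)
  | 8 => φ (zx 10)
  | _ => 1

variable {φ}

lemma zapPath_typeARelations_and_range_le (hrel : ZapRels10 ⊆ φ.ker) :
    TypeARelations (zapPath φ) 9 ∧ φ.range ≤ Subgroup.closure (zapPath φ '' Set.Iio 9) := by
  have sq (i : ℕ) (hi : 1 ≤ i ∧ i ≤ 10) :
      φ (zx i hi) * φ (zx i hi) = 1 := by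
    rw [← map_mul, ← pow_two]
    exact hrel (Or.inl (Or.inl ⟨⟨i, hi⟩, rfl⟩))
  have braid {i j : ℕ} {hi : 1 ≤ i ∧ i ≤ 10} {hj : 1 ≤ j ∧ j ≤ 10} :=
    braid_of_pow_three (sq i hi) (sq j hj)
  have comm {i j : ℕ} {hi : 1 ≤ i ∧ i ≤ 10} {hj : 1 ≤ j ∧ j ≤ 10} :=
    commute_of_pow_two (sq i hi) (sq j hj)
  simp only [ZapRels10, Set.union_subset_iff, Set.insert_subset_iff, Set.singleton_subset_iff,
    SetLike.mem_coe, MonoidHom.mem_ker, map_mul, map_pow, map_inv] at hrel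
  obtain ⟨⟨-, b₁₂, b₁₄, b₂₃, -, b₄₆, -, b₆₇, b₇₈, b₈₉, b₉₁₀, -, -, -, long⟩,
    c₁₃, c₁₅, c₁₆, c₁₇, c₁₈, c₁₉, c₁₁₀, c₂₆, c₂₇, c₂₈, c₂₉, c₂₁₀, c₃₄, c₃₆, c₃₇, c₃₈, c₃₉, c₃₁₀,
    c₄₈, c₄₉, c₄₁₀, c₅₆, c₆₈, c₆₉, c₆₁₀, c₇₉, c₇₁₀, c₈₁₀⟩ := hrel
  rw [mul_inv_eq_one] at long
  obtain ⟨c₄₂, c₄₇⟩ := commute_of_long_relation (sq 1 _) (sq 2 _) (sq 3 _) (sq 4 _) (sq 6 _)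
    (sq 7 _) (sq 8 _) (sq 9 _) (sq 10 _) (braid b₁₂) (braid b₁₄) (braid b₆₇) (braid b₇₈)
    (by simp [comm c₁₃, comm c₁₅, comm c₁₆, comm c₁₇, comm c₁₈, comm c₁₉, comm c₁₁₀])
    (by simp [comm c₂₇, comm c₂₈, comm c₂₉, comm c₂₁₀])
    (by simp [comm c₃₄, comm c₃₇, comm c₃₈, comm c₃₉, comm c₃₁₀])
    (by simp [comm c₄₈, comm c₄₉, comm c₄₁₀])
    (by simp [(comm c₅₆).symm, comm c₆₈, comm c₆₉, comm c₆₁₀])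
    (by simp [comm c₇₉, comm c₇₁₀]) long
  refine ⟨⟨?_, ?_, ?_⟩, ?_⟩
  · intro i hi
    interval_cases i <;> exact sq _ _
  · intro i hi
    have hi' : i < 8 := by omega
    interval_cases i
    exacts [braid b₂₃, braid b₁₂, (braid b₁₄).symm, (braid b₄₆).symm, (braid b₆₇).symm,
      (braid b₇₈).symm, (braid b₈₉).symm, (braid b₉₁₀).symm]
  · intro i j hij hj
    have hi : i < 7 := by omega
    interval_cases i <;> interval_cases j
    exacts [(comm c₁₃).symm, comm c₃₄, comm c₃₆, comm c₃₇, comm c₃₈, comm c₃₉, comm c₃₁₀,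
      c₄₂.symm, comm c₂₆, comm c₂₇, comm c₂₈, comm c₂₉, comm c₂₁₀,
      comm c₁₆, comm c₁₇, comm c₁₈, comm c₁₉, comm c₁₁₀,
      c₄₇, comm c₄₈, comm c₄₉, comm c₄₁₀, comm c₆₈, comm c₆₉, comm c₆₁₀,
      comm c₇₉, comm c₇₁₀, comm c₈₁₀]
  · have mem (j : ℕ) (hj : j < 9) : zapPath φ j ∈ Subgroup.closure (zapPath φ '' Set.Iio 9) :=
      Subgroup.subset_closure ⟨j, hj, rfl⟩
    have m3 := mem 0 (by norm_num)
    have m2 := mem 1 (by norm_num)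
    have m1 := mem 2 (by norm_num)
    have m4 := mem 3 (by norm_num)
    have m6 := mem 4 (by norm_num)
    have m7 := mem 5 (by norm_num)
    have m8 := mem 6 (by norm_num)
    have m9 := mem 7 (by norm_num)
    have m10 := mem 8 (by norm_num)
    have m5 : φ (zx 5) ∈ Subgroup.closure (zapPath φ '' Set.Iio 9) := by
      have hl := mul_mem (mul_mem (mul_mem (mul_mem (mul_mem (mul_mem m4 m3) m2) m1) m2) m3) m4
      simp only [zapPath] at *
      rw [long] at hl
      simpa only [m6, m7, m8, m9, m10, Subgroup.mul_mem_cancel_right,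
        Subgroup.mul_mem_cancel_left, mul_mem] using hl
    rw [MonoidHom.range_eq_map, ← FreeGroup.closure_range_of, Subgroup.map_le_iff_le_comap,
      Subgroup.closure_le]
    rintro _ ⟨⟨i, h₁, h₂⟩, rfl⟩
    interval_cases i
    exacts [m1, m2, m3, m4, m5, m6, m7, m8, m9, m10]

end Path

/-- The group `G^{10}_*` presented by the above relators is isomorphic to the
symmetric group `S_10`. -/
theorem zappatic_E10_presentation_iso_S10 :
    Nonempty (PresentedGroup ZapRels10 ≃* Equiv.Perm (Fin 10)) := by
  obtain ⟨hrel, hrange⟩ := zapPath_typeARelations_and_range_le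
    (φ := PresentedGroup.mk ZapRels10) fun r hr => PresentedGroup.one_of_mem hr
  obtain ⟨hfin, hcard⟩ := hrel.finite_and_card_closure_le
  rw [MonoidHom.range_eq_top.2 (PresentedGroup.mk_surjective _), top_le_iff] at hrange
  rw [hrange, Subgroup.coe_top] at hfin hcard
  have : Finite (PresentedGroup ZapRels10) := Set.finite_univ_iff.1 hfin
  refine ⟨MulEquiv.ofBijective _
    (toGroup_zapSwap_surjective.bijective_of_nat_card_le ?_)⟩
  rw [← Nat.card_univ, Nat.card_eq_fintype_card (α := Equiv.Perm _), Fintype.card_perm,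
    Fintype.card_fin]
  exact hcard
end

section
/- Let G be a group and let x_1, …, x_10 ∈ G satisfy: x_i² = e for i = 1,…,10; (x_i x_j)³ = e for each pair {i,j} ∈ {{1,2},{1,4},{2,3},{3,5},{4,6},{5,10},{6,7},{7,8},{8,9},{9,10}}; (x_5 · x_10 x_9 x_10)³ = e; (x_5 · x_10 x_9 x_10 x_8 x_10 x_9 x_10)³ = e; (x_5 · x_10 x_9 x_10 x_8 x_10 x_9 x_10 x_7 x_10 x_9 x_10 x_8 x_10 x_9 x_10)³ = e; x_4 x_3 x_2 x_1 x_2 x_3 x_4 = x_6 x_7 x_10 x_9 x_10 x_8 x_10 x_9 x_10 x_7 x_5 x_7 x_10 x_9 x_10 x_8 x_10 x_9 x_10 x_7 x_6; and (x_i x_j)² = e for each pair {i,j} ∈ {{1,3},{1,5},{1,6},{1,7},{1,8},{1,9},{1,10},{2,6},{2,7},{2,8},{2,9},{2,10},{3,4},{3,6},{3,7},{3,8},{3,9},{3,10},{4,8},{4,9},{4,10},{5,6},{6,8},{6,9},{6,10},{7,9},{7,10},{8,10}}. Then x_5 commutes with x_9 and x_5 commutes with x_8, i.e., (x_5 x_9)²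 = e and (x_5 x_8)² = e. -/
section Involutions

variable {G : Type*} [Group G] {a b c x : G}

theorem mul_mul_cancel_of_sq_eq_one (ha : a ^ 2 = 1) (y : G) : a * (a * y) = y := by
  rw [← mul_assoc, ← sq, ha, one_mul]

theorem commute_of_mul_sq_eq_one (ha : a ^ 2 = 1) (hb : b ^ 2 = 1) (h : (a * b) ^ 2 = 1) :
    Commute a b := by
  rw [sq] at ha hb h
  have := mul_eq_one_iff_eq_inv.mp h
  rwa [mul_inv_rev, ← eq_inv_of_mul_eq_one_left ha, ← eq_inv_of_mul_eq_one_left hb] at this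

theorem mul_sq_eq_one_of_commute (ha : a ^ 2 = 1) (hb : b ^ 2 = 1) (h : Commute a b) :
    (a * b) ^ 2 = 1 := by
  rw [h.mul_pow, ha, hb, one_mul]

theorem braid_of_mul_pow_three_eq_one (ha : a ^ 2 = 1) (hb : b ^ 2 = 1)
    (h : (a * b) ^ 3 = 1) : a * b * a = b * a * b := by
  rw [sq] at ha hb
  have h' : a * b * a * (b * a * b) = 1 := by
    rw [← h]; simp only [pow_succ, pow_zero, one_mul, mul_assoc]
  rw [mul_eq_one_iff_eq_inv.mp h', mul_inv_rev, mul_inv_rev,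
    ← eq_inv_of_mul_eq_one_left ha, ← eq_inv_of_mul_eq_one_left hb, ← mul_assoc]

theorem commute_of_commute_conj (ha : a ^ 2 = 1) (hba : Commute b a)
    (h : Commute b (a * x * a)) : Commute b x := by
  have hx : a * (a * x * a) * a = x := by
    simp only [mul_assoc, mul_mul_cancel_of_sq_eq_one ha, ← sq, ha, mul_one]
  rw [← hx]
  exact (hba.mul_right h).mul_right hba

theorem conj_sq_eq_one (ha : a ^ 2 = 1) (hb : b ^ 2 = 1) : (a * b * a) ^ 2 = 1 := by
  simp only [sq, mul_assoc, mul_mul_cancel_of_sq_eq_one ha, mul_mul_cancel_of_sq_eq_one hb]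
  rw [← sq, ha]

/-- In the symmetric group, `(2 3)` commutes with `(1 4) = (1 2)(2 3)(3 4)(2 3)(1 2)`. -/
theorem commute_conj_conj_of_braid_s2 (hab : a * b * a = b * a * b)
    (hac : Commute a c) : Commute b (a * (b * c * b) * a) := by
  have hl : b * a * b * c * b * a = a * b * a * c * b * a := by rw [hab]
  have hr : a * b * c * (b * a * b) = a * b * c * (a * b * a) := by rw [hab]
  have hm : a * b * (a * c) * b * a = a * b * (c * a) * b * a := by rw [hac.eq]
  simp only [Commute, SemiconjBy, mul_assoc] at *
  rw [hl, hm, hr]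

end Involutions

theorem zappatic_E10_x5_comm_x9_x8 {G : Type*} [Group G]
    (x1 x2 x3 x4 x5 x6 x7 x8 x9 x10 : G)
    (h1 : x1 ^ 2 = 1) (h2 : x2 ^ 2 = 1) (h3 : x3 ^ 2 = 1) (h4 : x4 ^ 2 = 1)
    (h5 : x5 ^ 2 = 1) (h6 : x6 ^ 2 = 1) (h7 : x7 ^ 2 = 1) (h8 : x8 ^ 2 = 1)
    (h9 : x9 ^ 2 = 1) (h10 : x10 ^ 2 = 1)
    (b12 : (x1 * x2) ^ 3 = 1) (b14 : (x1 * x4) ^ 3 = 1) (b23 : (x2 * x3) ^ 3 = 1)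
    (b35 : (x3 * x5) ^ 3 = 1) (b46 : (x4 * x6) ^ 3 = 1) (b5_10 : (x5 * x10) ^ 3 = 1)
    (b67 : (x6 * x7) ^ 3 = 1) (b78 : (x7 * x8) ^ 3 = 1) (b89 : (x8 * x9) ^ 3 = 1)
    (b9_10 : (x9 * x10) ^ 3 = 1)
    (blong1 : (x5 * (x10 * x9 * x10)) ^ 3 = 1)
    (blong2 : (x5 * (x10 * x9 * x10 * x8 * x10 * x9 * x10)) ^ 3 = 1)
    (blong3 : (x5 * (x10 * x9 * x10 * x8 * x10 * x9 * x10 * x7 *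
        x10 * x9 * x10 * x8 * x10 * x9 * x10)) ^ 3 = 1)
    (hstar : x4 * x3 * x2 * x1 * x2 * x3 * x4 =
      x6 * x7 * x10 * x9 * x10 * x8 * x10 * x9 * x10 * x7 *
        x5 * x7 * x10 * x9 * x10 * x8 * x10 * x9 * x10 * x7 * x6)
    (c13 : (x1 * x3) ^ 2 = 1) (c15 : (x1 * x5) ^ 2 = 1) (c16 : (x1 * x6) ^ 2 = 1)
    (c17 : (x1 * x7) ^ 2 = 1) (c18 : (x1 * x8) ^ 2 = 1) (c19 : (x1 * x9) ^ 2 = 1)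
    (c1_10 : (x1 * x10) ^ 2 = 1)
    (c26 : (x2 * x6) ^ 2 = 1) (c27 : (x2 * x7) ^ 2 = 1) (c28 : (x2 * x8) ^ 2 = 1)
    (c29 : (x2 * x9) ^ 2 = 1) (c2_10 : (x2 * x10) ^ 2 = 1)
    (c34 : (x3 * x4) ^ 2 = 1) (c36 : (x3 * x6) ^ 2 = 1) (c37 : (x3 * x7) ^ 2 = 1)
    (c38 : (x3 * x8) ^ 2 = 1) (c39 : (x3 * x9) ^ 2 = 1) (c3_10 : (x3 * x10) ^ 2 = 1)
    (c48 : (x4 * x8) ^ 2 = 1) (c49 : (x4 * x9) ^ 2 = 1) (c4_10 : (x4 * x10) ^ 2 = 1)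
    (c56 : (x5 * x6) ^ 2 = 1)
    (c68 : (x6 * x8) ^ 2 = 1) (c69 : (x6 * x9) ^ 2 = 1) (c6_10 : (x6 * x10) ^ 2 = 1)
    (c79 : (x7 * x9) ^ 2 = 1) (c7_10 : (x7 * x10) ^ 2 = 1)
    (c8_10 : (x8 * x10) ^ 2 = 1) :
    (x5 * x9) ^ 2 = 1 ∧ (x5 * x8) ^ 2 = 1 := by
  have e78 := braid_of_mul_pow_three_eq_one h7 h8 b78
  have e89 := braid_of_mul_pow_three_eq_one h8 h9 b89
  have e9_10 := braid_of_mul_pow_three_eq_one h9 h10 b9_10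
  have k79 := commute_of_mul_sq_eq_one h7 h9 c79
  have k7_10 := commute_of_mul_sq_eq_one h7 h10 c7_10
  have k8_10 := commute_of_mul_sq_eq_one h8 h10 c8_10
  have k68 := commute_of_mul_sq_eq_one h6 h8 c68
  have k69 := commute_of_mul_sq_eq_one h6 h9 c69
  set t := x10 * x9 * x10 with ht
  set s := t * x8 * t with hs
  have ht2 : t ^ 2 = 1 := conj_sq_eq_one h10 h9
  have hs2 : s ^ 2 = 1 := conj_sq_eq_one ht2 h8
  have hr2 : (x7 * s * x7) ^ 2 = 1 := conj_sq_eq_one h7 hs2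
  have hs_nested : s = x10 * (x9 * x8 * x9) * x10 := by
    have h : x10 * x9 * (x10 * x8 * x10) * x9 * x10 = x10 * x9 * x8 * x9 * x10 := by
      rw [← k8_10.eq, mul_assoc x8, ← sq, h10, mul_one]
    simpa only [hs, ht, mul_assoc] using h
  have hs_conj : s = x8 * t * x8 := by
    have h : x10 * x8 * x9 * (x8 * x10) = x8 * x10 * x9 * (x10 * x8) := by rw [k8_10.eq]
    rw [hs_nested, ← e89, ht]
    simpa only [mul_assoc] using h
  have hs9 : Commute x9 s := by
    rw [hs_nested]
    exact commute_conj_conj_of_braid_s2 e9_10.symm k8_10.symm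
  have hr9 : Commute x9 (x7 * s * x7) := (k79.symm.mul_right hs9).mul_right k79.symm
  have hr8 : Commute x8 (x7 * s * x7) := by
    have k7t : Commute x7 t := (k7_10.mul_right k79).mul_right k7_10
    rw [hs_conj]
    exact commute_conj_conj_of_braid_s2 e78 k7t
  have hstar' : x4 * x3 * x2 * x1 * x2 * x3 * x4 =
      x6 * ((x7 * s * x7) * x5 * (x7 * s * x7)) * x6 := by
    rw [hstar]
    simp only [hs, ht, mul_assoc]
  have descend : ∀ y, Commute y x1 → Commute y x2 → Commute y x3 → Commute y x4 →
      Commute y x6 → Commute y (x7 * s * x7) → Commute y x5 := by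
    intro y k1 k2 k3 k4 k6 kr
    refine commute_of_commute_conj hr2 kr (commute_of_commute_conj h6 k6 ?_)
    rw [← hstar']
    exact (((((k4.mul_right k3).mul_right k2).mul_right k1).mul_right k2).mul_right k3).mul_right k4
  have k59 := descend x9 (commute_of_mul_sq_eq_one h1 h9 c19).symm
    (commute_of_mul_sq_eq_one h2 h9 c29).symm (commute_of_mul_sq_eq_one h3 h9 c39).symm
    (commute_of_mul_sq_eq_one h4 h9 c49).symm k69.symm hr9
  have k58 := descend x8 (commute_of_mul_sq_eq_one h1 h8 c18).symm
    (commute_of_mul_sq_eq_one h2 h8 c28).symm (commute_of_mul_sq_eq_one h3 h8 c38).symm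
    (commute_of_mul_sq_eq_one h4 h8 c48).symm k68.symm hr8
  exact ⟨mul_sq_eq_one_of_commute h5 h9 k59.symm, mul_sq_eq_one_of_commute h5 h8 k58.symm⟩
end

section
/- Let G be a group and let x_1, …, x_10 ∈ G satisfy: x_i² = e for i = 1,…,10; (x_i x_j)³ = e for each pair {i,j} ∈ {{1,2},{1,4},{2,3},{3,5},{4,6},{5,10},{6,7},{7,8},{8,9},{9,10}}; (x_5 · x_10 x_9 x_10)³ = e; (x_5 · x_10 x_9 x_10 x_8 x_10 x_9 x_10)³ = e; (x_5 · x_10 x_9 x_10 x_8 x_10 x_9 x_10 x_7 x_10 x_9 x_10 x_8 x_10 x_9 x_10)³ = e; x_4 x_3 x_2 x_1 x_2 x_3 x_4 = x_6 x_7 x_10 x_9 x_10 x_8 x_10 x_9 x_10 x_7 x_5 x_7 x_10 x_9 x_10 x_8 x_10 x_9 x_10 x_7 x_6; and (x_i x_j)² = e for each pair {i,j} ∈ {{1,3},{1,5},{1,6},{1,7},{1,8},{1,9},{1,10},{2,6},{2,7},{2,8},{2,9},{2,10},{3,4},{3,6},{3,7},{3,8},{3,9},{3,10},{4,8},{4,9},{4,10},{5,6},{6,8},{6,9},{6,10},{7,9},{7,10},{8,10}}.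 Then x_2 commutes with x_5 and x_4 commutes with x_5, i.e., (x_2 x_5)² = e and (x_4 x_5)² = e. -/
section Involutions

variable {G : Type*} [Group G] {u x y z : G}

theorem commute_of_mul_sq_eq_one_s4 (hx : x * x = 1) (hy : y * y = 1) (h : (x * y) ^ 2 = 1) :
    Commute x y := by
  have h' : x * y = (x * y)⁻¹ := eq_inv_of_mul_eq_one_left (by rwa [sq] at h)
  rwa [mul_inv_rev, ← eq_inv_of_mul_eq_one_left hx, ← eq_inv_of_mul_eq_one_left hy] at h'

theorem Commute.mul_sq_eq_one (h : Commute x y) (hx : x * x = 1) (hy : y * y = 1) :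
    (x * y) ^ 2 = 1 := by
  rw [h.mul_pow, sq, sq, hx, hy, one_mul]

theorem braid_of_mul_cube_eq_one (hx : x * x = 1) (hy : y * y = 1) (h : (x * y) ^ 3 = 1) :
    x * y * x = y * x * y := by
  have h' : x * y * x = (y * x * y)⁻¹ :=
    eq_inv_of_mul_eq_one_left (by simpa [pow_succ, mul_assoc] using h)
  rwa [mul_inv_rev, mul_inv_rev, ← eq_inv_of_mul_eq_one_left hx,
    ← eq_inv_of_mul_eq_one_left hy, ← mul_assoc] at h'

theorem conj_mul_self_s4 (hu : u * u = 1) (hx : x * x = 1) : u * x * u * (u * x * u) = 1 := by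
  rw [show u * x * u * (u * x * u) = u * x * (u * u) * x * u by group, hu, mul_one,
    mul_assoc u, hx, mul_one, hu]

theorem conj_conj_self (hu : u * u = 1) : u * (u * x * u) * u = x := by
  rw [show u * (u * x * u) * u = u * u * x * (u * u) by group, hu, one_mul, mul_one]

theorem conj_mul_conj_s4 (hu : u * u = 1) : u * x * u * (u * y * u) = u * (x * y) * u := by
  rw [show u * x * u * (u * y * u) = u * x * (u * u) * y * u by group, hu]
  group

theorem Commute.conj_involution (hu : u * u = 1) (h : Commute x y) :
    Commute (u * x * u) (u * y * u) := by
  rw [Commute, SemiconjBy, conj_mul_conj_s4 hu, conj_mul_conj_s4 hu, h.eq]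

theorem Commute.conj_right (hu : Commute x u) (hy : Commute x y) : Commute x (u * y * u) :=
  (hu.mul_right hy).mul_right hu

theorem Commute.of_conj_right (h : Commute x (u * y * u)) (huu : u * u = 1)
    (hu : Commute x u) : Commute x y := by
  simpa only [conj_conj_self huu] using hu.conj_right h

theorem Commute.conj_involution_eq (hu : u * u = 1) (h : Commute u x) : u * x * u = x := by
  rw [h.eq, mul_assoc, hu, mul_one]

theorem Commute.conj_conj_comm (h : Commute x y) :
    x * (y * z * y) * x = y * (x * z * x) * y := by
  calc x * (y * z * y) * x = x * y * z * (y * x) := by group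
    _ = y * x * z * (x * y) := by rw [h.eq]
    _ = y * (x * z * x) * y := by group

theorem braid_conj_right (hu : u * u = 1) (hux : Commute u x) (h : x * y * x = y * x * y) :
    x * (u * y * u) * x = u * y * u * x * (u * y * u) := by
  have hx := hux.conj_involution_eq hu
  calc x * (u * y * u) * x = u * x * u * (u * y * u) * (u * x * u) := by rw [hx]
    _ = u * y * u * (u * x * u) * (u * y * u) := by
      rw [conj_mul_conj_s4 hu, conj_mul_conj_s4 hu, conj_mul_conj_s4 hu, conj_mul_conj_s4 hu, h]
    _ = u * y * u * x * (u * y * u) := by rw [hx]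

theorem commute_conj_conj_of_braid_s4 (h : x * y * x = y * x * y) (hxz : Commute x z) :
    Commute y (x * (y * z * y) * x) := by
  calc y * (x * (y * z * y) * x) = y * x * y * z * y * x := by group
    _ = x * y * (x * z) * y * x := by rw [← h]; group
    _ = x * y * z * (x * y * x) := by rw [hxz.eq]; group
    _ = x * (y * z * y) * x * y := by rw [h]; group

/-- In a chain `x — y — z` of braiding involutions whose ends commute, conjugating the middle
element through either end gives the same involution. -/
theorem conj_conj_eq_of_braid (hxy : x * y * x = y * x * y) (hyz : y * z * y = z * y * z) (hxz : Commute x z) :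
    z * (y * x * y) * z = x * (y * z * y) * x := by
  rw [← hxy, hyz, hxz.conj_conj_comm]

theorem commute_of_commute_conj_conj (hx : x * x = 1) (hz : z * z = 1)
    (hxy : x * y * x = y * x * y) (hxz : x * z * x = z * x * z)
    (h : Commute x (z * (y * x * y) * z)) : Commute y z := by
  rw [← hxy] at h
  have hc : z * (x * (z * y * z) * x) * z = z * (x * y * x) * z := by
    calc z * (x * (z * y * z) * x) * z = z * x * z * y * (z * x * z) := by group
      _ = x * (z * (x * y * x) * z) * x := by rw [← hxz]; group
      _ = z * (x * y * x) * z := h.conj_involution_eq hx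
  have hy : z * y * z = y := by simpa using hc
  calc y * z = z * y * z * z := by rw [hy]
    _ = z * y := by rw [mul_assoc, hz, mul_one]

end Involutions


theorem zappatic_E10_x2_x4_comm_x5 {G : Type*} [Group G]
    (x1 x2 x3 x4 x5 x6 x7 x8 x9 x10 : G)
    (h1 : x1 ^ 2 = 1) (h2 : x2 ^ 2 = 1) (h3 : x3 ^ 2 = 1) (h4 : x4 ^ 2 = 1)
    (h5 : x5 ^ 2 = 1) (h6 : x6 ^ 2 = 1) (h7 : x7 ^ 2 = 1) (h8 : x8 ^ 2 = 1)
    (h9 : x9 ^ 2 = 1) (h10 : x10 ^ 2 = 1)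
    (b12 : (x1 * x2) ^ 3 = 1) (b14 : (x1 * x4) ^ 3 = 1) (b23 : (x2 * x3) ^ 3 = 1)
    (b35 : (x3 * x5) ^ 3 = 1) (b46 : (x4 * x6) ^ 3 = 1) (b5_10 : (x5 * x10) ^ 3 = 1)
    (b67 : (x6 * x7) ^ 3 = 1) (b78 : (x7 * x8) ^ 3 = 1) (b89 : (x8 * x9) ^ 3 = 1)
    (b9_10 : (x9 * x10) ^ 3 = 1)
    (blong1 : (x5 * (x10 * x9 * x10)) ^ 3 = 1)
    (blong2 : (x5 * (x10 * x9 * x10 * x8 * x10 * x9 * x10)) ^ 3 = 1)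
    (blong3 : (x5 * (x10 * x9 * x10 * x8 * x10 * x9 * x10 * x7 *
        x10 * x9 * x10 * x8 * x10 * x9 * x10)) ^ 3 = 1)
    (hstar : x4 * x3 * x2 * x1 * x2 * x3 * x4 =
      x6 * x7 * x10 * x9 * x10 * x8 * x10 * x9 * x10 * x7 *
        x5 * x7 * x10 * x9 * x10 * x8 * x10 * x9 * x10 * x7 * x6)
    (c13 : (x1 * x3) ^ 2 = 1) (c15 : (x1 * x5) ^ 2 = 1) (c16 : (x1 * x6) ^ 2 = 1)
    (c17 : (x1 * x7) ^ 2 = 1) (c18 : (x1 * x8) ^ 2 = 1) (c19 : (x1 * x9) ^ 2 = 1)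
    (c1_10 : (x1 * x10) ^ 2 = 1)
    (c26 : (x2 * x6) ^ 2 = 1) (c27 : (x2 * x7) ^ 2 = 1) (c28 : (x2 * x8) ^ 2 = 1)
    (c29 : (x2 * x9) ^ 2 = 1) (c2_10 : (x2 * x10) ^ 2 = 1)
    (c34 : (x3 * x4) ^ 2 = 1) (c36 : (x3 * x6) ^ 2 = 1) (c37 : (x3 * x7) ^ 2 = 1)
    (c38 : (x3 * x8) ^ 2 = 1) (c39 : (x3 * x9) ^ 2 = 1) (c3_10 : (x3 * x10) ^ 2 = 1)
    (c48 : (x4 * x8) ^ 2 = 1) (c49 : (x4 * x9) ^ 2 = 1) (c4_10 : (x4 * x10) ^ 2 = 1)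
    (c56 : (x5 * x6) ^ 2 = 1)
    (c68 : (x6 * x8) ^ 2 = 1) (c69 : (x6 * x9) ^ 2 = 1) (c6_10 : (x6 * x10) ^ 2 = 1)
    (c79 : (x7 * x9) ^ 2 = 1) (c7_10 : (x7 * x10) ^ 2 = 1)
    (c8_10 : (x8 * x10) ^ 2 = 1) :
    (x2 * x5) ^ 2 = 1 ∧ (x4 * x5) ^ 2 = 1 := by
  rw [sq] at h1 h2 h3 h4 h5 h6 h7 h8 h9 h10
  replace b12 := braid_of_mul_cube_eq_one h1 h2 b12
  replace b14 := braid_of_mul_cube_eq_one h1 h4 b14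
  replace b23 := braid_of_mul_cube_eq_one h2 h3 b23
  replace b46 := braid_of_mul_cube_eq_one h4 h6 b46
  replace b67 := braid_of_mul_cube_eq_one h6 h7 b67
  replace b78 := braid_of_mul_cube_eq_one h7 h8 b78
  replace c13 := commute_of_mul_sq_eq_one_s4 h1 h3 c13
  replace c15 := commute_of_mul_sq_eq_one_s4 h1 h5 c15
  replace c16 := commute_of_mul_sq_eq_one_s4 h1 h6 c16
  replace c17 := commute_of_mul_sq_eq_one_s4 h1 h7 c17
  replace c18 := commute_of_mul_sq_eq_one_s4 h1 h8 c18
  replace c19 := commute_of_mul_sq_eq_one_s4 h1 h9 c19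
  replace c1_10 := commute_of_mul_sq_eq_one_s4 h1 h10 c1_10
  replace c26 := commute_of_mul_sq_eq_one_s4 h2 h6 c26
  replace c27 := commute_of_mul_sq_eq_one_s4 h2 h7 c27
  replace c28 := commute_of_mul_sq_eq_one_s4 h2 h8 c28
  replace c29 := commute_of_mul_sq_eq_one_s4 h2 h9 c29
  replace c2_10 := commute_of_mul_sq_eq_one_s4 h2 h10 c2_10
  replace c34 := commute_of_mul_sq_eq_one_s4 h3 h4 c34
  replace c36 := commute_of_mul_sq_eq_one_s4 h3 h6 c36
  replace c37 := commute_of_mul_sq_eq_one_s4 h3 h7 c37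
  replace c38 := commute_of_mul_sq_eq_one_s4 h3 h8 c38
  replace c39 := commute_of_mul_sq_eq_one_s4 h3 h9 c39
  replace c3_10 := commute_of_mul_sq_eq_one_s4 h3 h10 c3_10
  replace c48 := commute_of_mul_sq_eq_one_s4 h4 h8 c48
  replace c49 := commute_of_mul_sq_eq_one_s4 h4 h9 c49
  replace c4_10 := commute_of_mul_sq_eq_one_s4 h4 h10 c4_10
  replace c56 := commute_of_mul_sq_eq_one_s4 h5 h6 c56
  replace c68 := commute_of_mul_sq_eq_one_s4 h6 h8 c68
  replace c69 := commute_of_mul_sq_eq_one_s4 h6 h9 c69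
  replace c6_10 := commute_of_mul_sq_eq_one_s4 h6 h10 c6_10
  replace c79 := commute_of_mul_sq_eq_one_s4 h7 h9 c79
  replace c7_10 := commute_of_mul_sq_eq_one_s4 h7 h10 c7_10
  obtain ⟨a, ha⟩ : ∃ a, a = x10 * x9 * x10 := ⟨_, rfl⟩
  obtain ⟨b, hb⟩ : ∃ b, b = a * x8 * a := ⟨_, rfl⟩
  obtain ⟨c, hc⟩ : ∃ c, c = b * x7 * b := ⟨_, rfl⟩
  obtain ⟨y, hy⟩ : ∃ y, y = x3 * (x2 * x1 * x2) * x3 := ⟨_, rfl⟩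
  have haa : a * a = 1 := ha ▸ conj_mul_self_s4 h10 h9
  have hbb : b * b = 1 := hb ▸ conj_mul_self_s4 haa h8
  have hcc : c * c = 1 := hc ▸ conj_mul_self_s4 hbb h7
  have comm_a {g : G} (h9 : Commute g x9) (h10 : Commute g x10) : Commute g a :=
    ha ▸ h10.conj_right h9
  have comm_b {g : G} (h8 : Commute g x8) (h9 : Commute g x9) (h10 : Commute g x10) :
      Commute g b :=
    hb ▸ (comm_a h9 h10).conj_right h8
  have comm_c {g : G} (h7 : Commute g x7) (h8 : Commute g x8) (h9 : Commute g x9)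
      (h10 : Commute g x10) : Commute g c :=
    hc ▸ (comm_b h8 h9 h10).conj_right h7
  have comm_y {g : G} (h1 : Commute g x1) (h2 : Commute g x2) (h3 : Commute g x3) :
      Commute g y :=
    hy ▸ h3.conj_right (h2.conj_right h1)
  have b7b : x7 * b * x7 = c := by
    rw [hc, hb]
    exact braid_conj_right haa (comm_a c79 c7_10).symm b78
  have b6c : x6 * c * x6 = c * x6 * c := by
    rw [hc]
    exact braid_conj_right hbb (comm_b c68 c69 c6_10).symm b67
  have ht : x4 * y * x4 = x6 * (c * x5 * c) * x6 := by
    calc x4 * y * x4 = x4 * x3 * x2 * x1 * x2 * x3 * x4 := by rw [hy]; group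
      _ = x6 * (x7 * (a * x8 * a) * x7 * x5 * (x7 * (a * x8 * a) * x7)) * x6 := by
        rw [hstar, ha]; group
      _ = x6 * (c * x5 * c) * x6 := by rw [← hb, b7b]
  have c1t : Commute x1 (x4 * y * x4) := by
    rw [ht]
    exact c16.conj_right ((comm_c c17 c18 c19 c1_10).conj_right c15)
  have c24 : Commute x2 x4 := by
    refine commute_of_commute_conj_conj h1 h4 b12 b14 (Commute.of_conj_right ?_ h3 c13)
    rwa [c34.conj_conj_comm, ← hy]
  have c2y : Commute x2 y := by
    rw [hy, conj_conj_eq_of_braid b12 b23 c13]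
    exact commute_conj_conj_of_braid_s4 b12 c13
  have c25 : Commute x2 x5 := by
    have h := c24.conj_right c2y
    rw [ht] at h
    exact (h.of_conj_right h6 c26).of_conj_right hcc (comm_c c27 c28 c29 c2_10)
  have b4y : x4 * y * x4 = y * x4 * y := by
    rw [hy]
    exact braid_conj_right h3 c34 (braid_conj_right h2 c24 b14.symm)
  have c6y : Commute x6 y := comm_y c16.symm c26.symm c36.symm
  have cct : Commute c (x4 * y * x4) := by
    have h := (c56.symm.conj_involution hcc).conj_involution h6
    rwa [← b6c, conj_conj_self h6, ← ht] at h
  have c8t : Commute x8 (x4 * y * x4) :=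
    c48.symm.conj_right (comm_y c18.symm c28.symm c38.symm)
  have c9t : Commute x9 (x4 * y * x4) :=
    c49.symm.conj_right (comm_y c19.symm c29.symm c39.symm)
  have c10t : Commute x10 (x4 * y * x4) :=
    c4_10.symm.conj_right (comm_y c1_10.symm c2_10.symm c3_10.symm)
  have c7t : Commute x7 (x4 * y * x4) := by
    rw [hc] at cct
    exact (cct.symm.of_conj_right hbb (comm_b c8t.symm c9t.symm c10t.symm)).symm
  have hyy : y * y = 1 := hy ▸ conj_mul_self_s4 h3 (conj_mul_self_s4 h2 h1)
  have c47 : Commute x4 x7 := by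
    rw [b4y] at c7t
    exact (c7t.of_conj_right hyy (comm_y c17.symm c27.symm c37.symm)).symm
  have c45 : Commute x4 x5 := by
    have h : Commute x4 (x6 * (x4 * y * x4) * x6) := commute_conj_conj_of_braid_s4 b46.symm c6y
    rw [ht, conj_conj_self h6] at h
    exact h.of_conj_right hcc (comm_c c47 c48 c49 c4_10)
  exact ⟨c25.mul_sq_eq_one h2 h5, c45.mul_sq_eq_one h4 h5⟩
end

section
/- Let G be a group and let a, b, c ∈ G satisfy a² = b² = c² = e, (ac)³ = e, (bc)³ = e, and (ab)² = e. Then (a · (c b c))³ = e. -/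
/-- Redundancy of `⟨x_5, x_10 x_9 x_10⟩ = e`: for involutions `a, b, c` with
`(ac)³ = (bc)³ = e` and `(ab)² = e`, one has `(a (cbc))³ = e`. -/
theorem braid_conj_redundant {G : Type*} [Group G] (a b c : G)
    (ha : a ^ 2 = 1) (hb : b ^ 2 = 1) (hc : c ^ 2 = 1)
    (hac : (a * c) ^ 3 = 1) (hbc : (b * c) ^ 3 = 1) (hab : (a * b) ^ 2 = 1) :
    (a * (c * b * c)) ^ 3 = 1 := by
  have hai : a⁻¹ = a := inv_eq_of_mul_eq_one_left (by rw [← sq, ha])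
  have hbi : b⁻¹ = b := inv_eq_of_mul_eq_one_left (by rw [← sq, hb])
  have hci : c⁻¹ = c := inv_eq_of_mul_eq_one_left (by rw [← sq, hc])
  have hcomm : a * b = b * a := by
    have h : a * b = (a * b)⁻¹ := eq_inv_of_mul_eq_one_left (by rw [← sq, hab])
    rwa [mul_inv_rev, hai, hbi] at h
  have hbraid : b * c * b = c * b * c := by
    have h : b * c * b = (c * b * c)⁻¹ :=
      eq_inv_of_mul_eq_one_left (by simpa only [pow_succ, pow_zero, one_mul, mul_assoc] using hbc)
    rwa [mul_inv_rev, mul_inv_rev, hbi, hci, ← mul_assoc] at h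
  have hconj : a * (c * b * c) = b * (a * c) * b⁻¹ := by
    rw [← hbraid, hbi, ← mul_assoc, ← mul_assoc, hcomm, mul_assoc b a c]
  rw [hconj, conj_pow, hac, mul_one, mul_inv_cancel]
end

section
/- Let G be a group and let a, b, c, d ∈ G satisfy a² = b² = c² = d² = e, (ad)³ = e, (cd)³ = e, (bc)³ = e, (ac)² = e, (ab)² = e, and (bd)² = e. Then (a · (d c d b d c d))³ = e. -/
theorem braid_of_mul_pow_three_eq_one_s8 {G : Type*} [Group G] {x y : G}
    (hx : x⁻¹ = x) (hy : y⁻¹ = y) (h : (x * y) ^ 3 = 1) : x * y * x = y * x * y := by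
  have h' : (x * y * x) * (y * x * y) = 1 := by
    rw [← h, pow_three]
    simp only [mul_assoc]
  rw [eq_inv_of_mul_eq_one_left h']
  simp only [mul_inv_rev, hx, hy, mul_assoc]

theorem commute_of_mul_pow_two_eq_one {G : Type*} [Group G] {x y : G}
    (hx : x⁻¹ = x) (hy : y⁻¹ = y) (h : (x * y) ^ 2 = 1) : Commute x y := by
  have h' : x * y = (x * y)⁻¹ := eq_inv_of_mul_eq_one_left (by rw [← pow_two, h])
  rwa [mul_inv_rev, hx, hy] at h'

/-- Redundancy of `⟨x_5, x_10 x_9 x_10 x_8 x_10 x_9 x_10⟩ = e`: for involutions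
`a, b, c, d` with `(ad)³ = (cd)³ = (bc)³ = e` and `(ac)² = (ab)² = (bd)² = e`,
one has `(a (dcdbdcd))³ = e`. -/
theorem braid_long_conj_redundant {G : Type*} [Group G] (a b c d : G)
    (ha : a ^ 2 = 1) (hb : b ^ 2 = 1) (hc : c ^ 2 = 1) (hd : d ^ 2 = 1)
    (had : (a * d) ^ 3 = 1) (hcd : (c * d) ^ 3 = 1) (hbc : (b * c) ^ 3 = 1)
    (hac : (a * c) ^ 2 = 1) (hab : (a * b) ^ 2 = 1) (hbd : (b * d) ^ 2 = 1) :
    (a * (d * c * d * b * d * c * d)) ^ 3 = 1 := by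
  have inv_self {x : G} (hx : x ^ 2 = 1) : x⁻¹ = x :=
    inv_eq_of_mul_eq_one_left (by rw [← pow_two, hx])
  have hb' := inv_self hb
  have hc' := inv_self hc
  have hd' := inv_self hd
  have hac' := commute_of_mul_pow_two_eq_one (inv_self ha) hc' hac
  have hab' := commute_of_mul_pow_two_eq_one (inv_self ha) hb' hab
  have hbd' := commute_of_mul_pow_two_eq_one hb' hd' hbd
  have hcd' := braid_of_mul_pow_three_eq_one_s8 hc' hd' hcd
  have hbc' := braid_of_mul_pow_three_eq_one_s8 hb' hc' hbc
  have key : d * c * d * b * d * c * d = b * c * d * (b * c)⁻¹ := by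
    calc d * c * d * b * d * c * d = (d * c * d) * b * (d * c * d) := by
          simp only [mul_assoc]
      _ = c * d * (c * b * c) * d * c := by rw [← hcd']; simp only [mul_assoc]
      _ = c * (d * b) * c * (b * d) * c := by rw [← hbc']; simp only [mul_assoc]
      _ = c * b * (d * c * d) * b * c := by
          rw [← hbd'.eq]
          nth_rewrite 2 [hbd'.eq]
          simp only [mul_assoc]
      _ = (c * b * c) * d * (c * b * c) := by rw [← hcd']; simp only [mul_assoc]
      _ = b * c * (b * d) * b * c * b := by rw [← hbc']; simp only [mul_assoc]
      _ = b * c * d * (b * b) * c * b := by rw [hbd'.eq]; simp only [mul_assoc]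
      _ = b * c * d * (b * c)⁻¹ := by
          rw [← pow_two, hb, mul_inv_rev, hb', hc']
          simp only [mul_assoc, one_mul]
  have hconj : a * (b * c * d * (b * c)⁻¹) = b * c * (a * d) * (b * c)⁻¹ := by
    simp only [← mul_assoc]
    rw [hab'.eq, mul_assoc b a c, hac'.eq, ← mul_assoc]
  rw [key, hconj, conj_pow, had, mul_one, mul_inv_cancel]
end
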